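/- arXiv:2301.01066 — 8 statements merged into one kernel-verified Lean document; each statement's English description precedes it below -/
import Mathlib

section
/- For every integer m ≥ 1, the equation (cosh(m·ω)/sinh(m·ω))·sinh(ω) = 3·cosh(ω) − 4 has exactly one root ω in the interval (0, ∞), and this root satisfies log(2 + √2) < ω ≤ log(2 + √3). -/
open Real Matrix Filter

noncomputable section

/-- Tridiagonal 0/1 matrix with ones on the sub- and super-diagonal. -/
def triMat (m : ℕ) : Matrix (Fin m) (Fin m) ℝ :=
  fun i j => if (i : ℤ) - (j : ℤ) = 1 ∨ (j : ℤ) - (i : ℤ) = 1 then 1 else 0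

/-- Crank–Nicolson iteration matrix `A_m(s)`. -/
def cnMat (m : ℕ) (s : ℝ) : Matrix (Fin m) (Fin m) ℝ :=
  ((1 + s) • (1 : Matrix (Fin m) (Fin m) ℝ) - (s / 2) • triMat m)⁻¹ *
    ((1 - s) • (1 : Matrix (Fin m) (Fin m) ℝ) + (s / 2) • triMat m)

/-- Maximum (row-sum) norm of a square matrix: max over rows of the sum of absolute values. -/
def maxNorm {m : ℕ} (A : Matrix (Fin m) (Fin m) ℝ) : ℝ :=
  ⨆ i, ∑ j, |A i j|

/-- Chebyshev polynomials of the second kind. -/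
def polyU : ℕ → Polynomial ℝ
  | 0 => 1
  | 1 => 2 * Polynomial.X
  | n + 2 => 2 * Polynomial.X * polyU (n + 1) - polyU n

/-- Polynomials `P_n`. -/
def polyP : ℕ → Polynomial ℝ
  | 0 => -1
  | 1 => 2 * Polynomial.X - 4
  | n + 2 => 2 * Polynomial.X * polyP (n + 1) - polyP n

/-- Polynomials `C_n`. -/
def polyC : ℕ → Polynomial ℝ
  | 0 => 0
  | 1 => 4 * (Polynomial.X - 1)
  | n + 2 => 2 * Polynomial.X * polyC (n + 1) - polyC n

/-- The equation `coth(mω)·sinh(ω) = 3·cosh(ω) − 4`. -/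
def cothEq (m : ℕ) (ω : ℝ) : Prop :=
  Real.cosh (m * ω) / Real.sinh (m * ω) * Real.sinh ω = 3 * Real.cosh ω - 4

/-- The contractivity equation for odd `m`. -/
def oddEq (m : ℕ) (ω : ℝ) : Prop :=
  2 * Real.sinh (((m : ℝ) - 1) * ω / 4) * Real.sinh (((m : ℝ) + 1) * ω / 4) =
    Real.sinh (ω / 2) * Real.sinh (((m : ℝ) + 1) * ω / 2)

/-- The contractivity equation for even `m`. -/
def evenEq (m : ℕ) (ω : ℝ) : Prop :=
  Real.sinh (ω / 2) ^ 2 * Real.sinh ((m : ℝ) * ω / 2) *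
      (Real.sinh (((m : ℝ) + 2) * ω / 2) - Real.sinh ((m : ℝ) * ω / 2)) =
    Real.sinh ω * Real.sinh (((m : ℝ) + 1) * ω / 2) * Real.sinh ((m : ℝ) * ω / 4) *
      Real.sinh (((m : ℝ) - 2) * ω / 4)

/-- The function `ω ↦ (3 cosh ω - 4) / sinh ω` is strictly increasing on `(0, ∞)`. -/
theorem three_cosh_sub_four_mul_sinh_lt {a b : ℝ} (ha : 0 < a) (hab : a < b) :
    (3 * Real.cosh a - 4) * Real.sinh b < (3 * Real.cosh b - 4) * Real.sinh a := by
  obtain ⟨u, v, rfl, rfl⟩ : ∃ u v : ℝ, a = u - v ∧ b = u + v :=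
    ⟨(a + b) / 2, (b - a) / 2, by ring, by ring⟩
  have hv : 0 < v := by linarith
  have hsv : 0 < Real.sinh v := Real.sinh_pos_iff.2 hv
  have hcv : 0 < Real.cosh v := Real.cosh_pos v
  have hc : Real.cosh v < Real.cosh u := by
    rw [Real.cosh_lt_cosh, abs_of_pos hv, abs_of_pos (by linarith)]
    linarith
  have key : (3 * Real.cosh (u + v) - 4) * Real.sinh (u - v)
      - (3 * Real.cosh (u - v) - 4) * Real.sinh (u + v)
      = 2 * Real.sinh v * (4 * Real.cosh u - 3 * Real.cosh v) := by
    rw [Real.cosh_add, Real.cosh_sub, Real.sinh_add, Real.sinh_sub]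
    linear_combination (-6 * Real.sinh v * Real.cosh v) * Real.cosh_sq u
  have : 0 < 2 * Real.sinh v * (4 * Real.cosh u - 3 * Real.cosh v) :=
    mul_pos (by linarith) (by linarith)
  linarith

/-- For `ω > 0` the equation can be cleared of its denominator. -/
theorem cothEq_iff {m : ℕ} (hm : 1 ≤ m) {ω : ℝ} (hω : 0 < ω) :
    cothEq m ω ↔
      Real.cosh (m * ω) * Real.sinh ω = (3 * Real.cosh ω - 4) * Real.sinh (m * ω) := by
  have hm' : (0 : ℝ) < m := by exact_mod_cast hm
  have hs : Real.sinh (m * ω) ≠ 0 := (Real.sinh_pos_iff.2 (mul_pos hm' hω)).ne'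
  rw [cothEq, div_mul_eq_mul_div, div_eq_iff hs]

/-- The equation has no two distinct positive roots. -/
theorem not_cothEq_of_lt {m : ℕ} (hm : 1 ≤ m) {a b : ℝ} (ha : 0 < a) (hab : a < b)
    (hea : cothEq m a) : ¬ cothEq m b := by
  intro heb
  have hb : 0 < b := ha.trans hab
  rw [cothEq_iff hm ha] at hea
  rw [cothEq_iff hm hb] at heb
  have hm' : (0 : ℝ) < m := by exact_mod_cast hm
  have hsa : 0 < Real.sinh a := Real.sinh_pos_iff.2 ha
  have hsb : 0 < Real.sinh b := Real.sinh_pos_iff.2 hb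
  have hma : 0 < Real.sinh (m * a) := Real.sinh_pos_iff.2 (mul_pos hm' ha)
  have hmb : 0 < Real.sinh (m * b) := Real.sinh_pos_iff.2 (mul_pos hm' hb)
  have hlt := three_cosh_sub_four_mul_sinh_lt ha hab
  have hd : 0 < Real.sinh (m * b - m * a) :=
    Real.sinh_pos_iff.2 (sub_pos.2 (mul_lt_mul_of_pos_left hab hm'))
  rw [Real.sinh_sub] at hd
  have h1 := mul_pos (mul_pos hma hmb) (sub_pos.2 hlt)
  have h2 := mul_pos (mul_pos hsa hsb) hd
  have h3 : Real.sinh (m * a) * Real.sinh (m * b) *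
        ((3 * Real.cosh b - 4) * Real.sinh a - (3 * Real.cosh a - 4) * Real.sinh b)
      = -(Real.sinh a * Real.sinh b * (Real.sinh (m * b) * Real.cosh (m * a)
          - Real.cosh (m * b) * Real.sinh (m * a))) := by
    linear_combination (Real.sinh (m * b) * Real.sinh b) * hea
      - (Real.sinh (m * a) * Real.sinh a) * heb
  linarith

theorem three_cosh_sub_four_eq_sinh_log_two_add_sqrt_two :
    3 * Real.cosh (Real.log (2 + √2)) - 4 = Real.sinh (Real.log (2 + √2)) := by
  have h : (0 : ℝ) < 2 + √2 := by positivity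
  have hinv : (2 + √2)⁻¹ = 1 - √2 / 2 := by
    refine inv_eq_of_mul_eq_one_right ?_
    linear_combination (-1 / 2) * Real.sq_sqrt (show (0 : ℝ) ≤ 2 by norm_num)
  rw [Real.cosh_log h, Real.sinh_log h, hinv]
  ring

theorem inv_two_add_sqrt_three : (2 + √3)⁻¹ = 2 - √3 := by
  refine inv_eq_of_mul_eq_one_right ?_
  linear_combination -Real.sq_sqrt (show (0 : ℝ) ≤ 3 by norm_num)

theorem cosh_log_two_add_sqrt_three : Real.cosh (Real.log (2 + √3)) = 2 := by
  rw [Real.cosh_log (by positivity), inv_two_add_sqrt_three]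
  ring

theorem stmt0 (m : ℕ) (hm : 1 ≤ m) :
    ∃ ω : ℝ, 0 < ω ∧ cothEq m ω ∧
      Real.log (2 + Real.sqrt 2) < ω ∧ ω ≤ Real.log (2 + Real.sqrt 3) ∧
      ∀ ω' : ℝ, 0 < ω' → cothEq m ω' → ω' = ω := by
  have hpos : 0 < Real.log (2 + √2) := Real.log_pos (by linarith [Real.sqrt_nonneg 2])
  have hle : Real.log (2 + √2) ≤ Real.log (2 + √3) :=
    Real.log_le_log (by positivity) (by gcongr; norm_num)
  have hlo := three_cosh_sub_four_eq_sinh_log_two_add_sqrt_two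
  have hhi := cosh_log_two_add_sqrt_three
  set a := Real.log (2 + √2)
  set b := Real.log (2 + √3)
  let F : ℝ → ℝ := fun x =>
    (3 * Real.cosh x - 4) * Real.sinh (m * x) - Real.cosh (m * x) * Real.sinh x
  have hF : Continuous F := by fun_prop
  have hFa : F a < 0 := by
    have h : F a = Real.sinh a * (Real.sinh (m * a) - Real.cosh (m * a)) := by
      simp only [F, hlo]
      ring
    rw [h]
    exact mul_neg_of_pos_of_neg (Real.sinh_pos_iff.2 hpos) (sub_neg.2 (Real.sinh_lt_cosh _))
  have hFb : 0 ≤ F b := by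
    have h : F b = Real.sinh (m * b - b) := by
      rw [Real.sinh_sub]
      simp only [F, hhi]
      ring
    have hm' : (1 : ℝ) ≤ m := by exact_mod_cast hm
    rw [h, Real.sinh_nonneg_iff]
    nlinarith
  obtain ⟨ω, ⟨haω, hωb⟩, hω⟩ := intermediate_value_Icc hle hF.continuousOn ⟨hFa.le, hFb⟩
  have hne : a ≠ ω := by
    rintro h
    rw [h, hω] at hFa
    exact lt_irrefl _ hFa
  have hω0 : 0 < ω := hpos.trans_le haω
  have hroot : cothEq m ω := (cothEq_iff hm hω0).2 (sub_eq_zero.1 hω).symm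
  refine ⟨ω, hω0, hroot, lt_of_le_of_ne haω hne, hωb, fun ω' hω' hroot' => ?_⟩
  rcases lt_trichotomy ω' ω with h | h | h
  · exact absurd hroot (not_cothEq_of_lt hm hω' h hroot')
  · exact h
  · exact absurd hroot' (not_cothEq_of_lt hm hω0 h hroot)
end
end

section
/- Let m ≥ 1 be an integer and let ω > 0 satisfy (cosh(m·ω)/sinh(m·ω))·sinh(ω) = 3·cosh(ω) − 4. Then for every real s > 0, all entries of the Crank–Nicolson matrix A_m(s) are nonnegative if and only if s ≤ 1/(cosh(ω) − 1). -/
open Real Matrix Filter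

noncomputable section

/-- Hyperbolic cotangent. -/
def coth (x : ℝ) : ℝ := Real.cosh x / Real.sinh x

theorem coth_strictAntiOn : StrictAntiOn coth (Set.Ioi 0) := by
  intro a ha b hb hab
  rw [Set.mem_Ioi] at ha hb
  have h := Real.sinh_pos_iff.2 (sub_pos.2 hab)
  rw [Real.sinh_sub] at h
  unfold coth
  rw [div_lt_div_iff₀ (Real.sinh_pos_iff.2 hb) (Real.sinh_pos_iff.2 ha)]
  linarith

theorem coth_pos {x : ℝ} (hx : 0 < x) : 0 < coth x :=
  div_pos (Real.cosh_pos x) (Real.sinh_pos_iff.2 hx)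

theorem cosh_sub_one_pos {x : ℝ} (hx : 0 < x) : 0 < Real.cosh x - 1 :=
  sub_pos.2 (Real.one_lt_cosh.2 hx.ne')

theorem sinh_eq_coth_half_mul {x : ℝ} (hx : 0 < x) :
    Real.sinh x = coth (x / 2) * (Real.cosh x - 1) := by
  have h := (Real.sinh_pos_iff.2 (half_pos hx)).ne'
  have h1 := Real.sinh_two_mul (x / 2)
  have h2 := Real.cosh_two_mul (x / 2)
  have h3 := Real.cosh_sq (x / 2)
  rw [mul_div_cancel₀ x two_ne_zero] at h1 h2
  rw [h1, h2, h3, coth]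
  field_simp
  ring

theorem inv_cosh_sub_one_add_coth_mul_strictAntiOn {m : ℕ} (hm : 1 ≤ m) :
    StrictAntiOn (fun x : ℝ => (Real.cosh x - 1)⁻¹ + coth (x / 2) * coth (m * x))
      (Set.Ioi 0) := by
  intro a ha b hb hab
  rw [Set.mem_Ioi] at ha hb
  have hm' : (0 : ℝ) < m := by exact_mod_cast hm
  have h1 : (Real.cosh b - 1)⁻¹ < (Real.cosh a - 1)⁻¹ := by
    refine inv_strictAnti₀ (cosh_sub_one_pos ha) (sub_lt_sub_right ?_ 1)
    exact Real.cosh_lt_cosh.2 (by rwa [abs_of_pos ha, abs_of_pos hb])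
  have h2 : coth (b / 2) < coth (a / 2) :=
    coth_strictAntiOn (half_pos ha) (half_pos hb) (by linarith)
  have h3 : coth (m * b) < coth (m * a) :=
    coth_strictAntiOn (mul_pos hm' ha) (mul_pos hm' hb) (mul_lt_mul_of_pos_left hab hm')
  have h4 := mul_lt_mul'' h2 h3 (coth_pos (half_pos hb)).le (coth_pos (mul_pos hm' hb)).le
  exact add_lt_add h1 h4

theorem coth_mul_sinh_sub (m : ℕ) {x : ℝ} (hx : 0 < x) :
    coth (m * x) * Real.sinh x - (3 * Real.cosh x - 4) =
      (Real.cosh x - 1) *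
        ((Real.cosh x - 1)⁻¹ + coth (x / 2) * coth (m * x) - 3) := by
  have h := (cosh_sub_one_pos hx).ne'
  rw [sinh_eq_coth_half_mul hx]
  field_simp
  ring

/-- The inequality relaxing `cothEq` holds exactly beyond the root `ω`. -/
theorem coth_mul_sinh_le_iff {m : ℕ} (hm : 1 ≤ m) {ω x : ℝ} (hω : 0 < ω) (hx : 0 < x)
    (heq : cothEq m ω) :
    coth (m * x) * Real.sinh x ≤ 3 * Real.cosh x - 4 ↔ ω ≤ x := by
  have hroot := coth_mul_sinh_sub m hω
  rw [sub_eq_zero.2 (show coth (m * ω) * Real.sinh ω = _ from heq), eq_comm, mul_eq_zero,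
    or_iff_right (cosh_sub_one_pos hω).ne', sub_eq_zero] at hroot
  rw [← (inv_cosh_sub_one_add_coth_mul_strictAntiOn hm).le_iff_ge (a := x) (b := ω) hx hω, hroot,
    ← sub_nonpos, coth_mul_sinh_sub m hx, mul_nonpos_iff_pos_imp_nonpos]
  have := cosh_sub_one_pos hx
  constructor
  · intro h
    linarith [h.1 this]
  · intro h
    exact ⟨fun _ => by linarith, fun _ => this.le⟩

theorem sum_ite_int_cast_eq {m : ℕ} (g : ℤ → ℝ) (h0 : g (-1) = 0) (h1 : g m = 0) (a : ℤ)
    (ha : -1 ≤ a) (ha' : a ≤ m) :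
    ∑ k : Fin m, (if (k : ℤ) = a then g k else 0) = g a := by
  by_cases h : 0 ≤ a ∧ a < m
  · lift a to ℕ using h.1
    have hlt : a < m := by exact_mod_cast h.2
    rw [Finset.sum_eq_single ⟨a, hlt⟩]
    · simp
    · intro b _ hb
      rw [if_neg]
      exact fun h => hb (Fin.ext (by exact_mod_cast h))
    · simp
  · have : g a = 0 := by
      rcases (by omega : a = -1 ∨ a = m) with rfl | rfl <;> assumption
    rw [this]
    refine Finset.sum_eq_zero fun k _ => if_neg ?_
    have := k.isLt
    omega

theorem triMat_sum_mul {m : ℕ} (g : ℤ → ℝ) (h0 : g (-1) = 0) (h1 : g m = 0) (i : Fin m) :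
    ∑ k, triMat m i k * g k = g (i - 1) + g (i + 1) := by
  have hi := i.isLt
  rw [← sum_ite_int_cast_eq g h0 h1 (i - 1) (by omega) (by omega),
    ← sum_ite_int_cast_eq g h0 h1 (i + 1) (by omega) (by omega), ← Finset.sum_add_distrib]
  refine Finset.sum_congr rfl fun k _ => ?_
  unfold triMat
  split_ifs <;> first | omega | simp

/-- The discrete Green's function of `2 cosh θ - T`, up to normalisation. -/
def green (m : ℕ) (θ : ℝ) (i j : ℤ) : ℝ :=
  Real.sinh ((min i j + 1 : ℤ) * θ) * Real.sinh ((m - max i j : ℤ) * θ)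

theorem sinh_add_one_mul_add (k θ : ℝ) :
    Real.sinh ((k + 1) * θ) + Real.sinh ((k - 1) * θ) =
      2 * Real.cosh θ * Real.sinh (k * θ) := by
  rw [add_mul, sub_mul, one_mul, Real.sinh_add, Real.sinh_sub]
  ring

theorem sinh_mul_sinh_sub (a b c : ℝ) :
    Real.sinh (a + c) * Real.sinh (b + c) - Real.sinh a * Real.sinh b =
      Real.sinh c * Real.sinh (a + b + c) := by
  have h := Real.cosh_sq c
  simp only [Real.sinh_add, Real.cosh_add]
  linear_combination Real.sinh a * Real.sinh b * h

theorem green_recurrence (m : ℕ) (θ : ℝ) (i j : ℤ) :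
    2 * Real.cosh θ * green m θ i j - (green m θ (i - 1) j + green m θ (i + 1) j) =
      if i = j then Real.sinh θ * Real.sinh ((m + 1) * θ) else 0 := by
  unfold green
  rcases lt_trichotomy i j with h | rfl | h
  · rw [if_neg h.ne, min_eq_left h.le, min_eq_left (by omega : i - 1 ≤ j),
      min_eq_left (by omega : i + 1 ≤ j), max_eq_right h.le,
      max_eq_right (by omega : i - 1 ≤ j), max_eq_right (by omega : i + 1 ≤ j)]
    have := sinh_add_one_mul_add (i + 1) θ
    push_cast
    rw [show (i : ℝ) - 1 + 1 = i + 1 - 1 by ring]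
    linear_combination -Real.sinh ((m - j : ℝ) * θ) * this
  · rw [if_pos rfl, min_self, max_self, min_eq_left (by omega : i - 1 ≤ i),
      max_eq_right (by omega : i - 1 ≤ i), min_eq_right (by omega : i ≤ i + 1),
      max_eq_left (by omega : i ≤ i + 1)]
    have h1 := sinh_add_one_mul_add (i + 1) θ
    have h2 := sinh_mul_sinh_sub ((i + 1) * θ) ((m - i - 1) * θ) θ
    rw [show ((i : ℝ) + 1) * θ + (m - i - 1) * θ + θ = (m + 1) * θ by ring,
      show ((i : ℝ) + 1) * θ + θ = (i + 1 + 1) * θ by ring,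
      show ((m : ℝ) - i - 1) * θ + θ = (m - i) * θ by ring] at h2
    push_cast
    rw [show (i : ℝ) - 1 + 1 = i + 1 - 1 by ring, show (m : ℝ) - (i + 1) = m - i - 1 by ring]
    linear_combination -Real.sinh ((m - i : ℝ) * θ) * h1 + h2
  · rw [if_neg h.ne', min_eq_right h.le, min_eq_right (by omega : j ≤ i - 1),
      min_eq_right (by omega : j ≤ i + 1), max_eq_left h.le,
      max_eq_left (by omega : j ≤ i - 1), max_eq_left (by omega : j ≤ i + 1)]
    have := sinh_add_one_mul_add (m - i) θ
    push_cast
    rw [show (m : ℝ) - (i - 1) = m - i + 1 by ring, show (m : ℝ) - (i + 1) = m - i - 1 by ring]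
    linear_combination -Real.sinh ((j + 1 : ℝ) * θ) * this

theorem cnMat_apply (m : ℕ) {s θ : ℝ} (hs : 0 < s) (hθ : 0 < θ)
    (h : s * Real.cosh θ = 1 + s) (i j : Fin m) :
    cnMat m s i j = 4 / s * green m θ i j / (Real.sinh θ * Real.sinh ((m + 1) * θ)) -
      if i = j then 1 else 0 := by
  set D := Real.sinh θ * Real.sinh ((m + 1) * θ) with hD
  have hDpos : 0 < D :=
    mul_pos (Real.sinh_pos_iff.2 hθ) (Real.sinh_pos_iff.2 (by positivity))
  set M := (1 + s) • (1 : Matrix (Fin m) (Fin m) ℝ) - (s / 2) • triMat m with hM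
  let B : Matrix (Fin m) (Fin m) ℝ := Matrix.of fun i j => 2 / s * green m θ i j / D
  have hMB : M * B = 1 := by
    ext i j
    have hsum := triMat_sum_mul (fun k => green m θ k j) (by simp [green])
      (by simp [green]) i
    have hrec := green_recurrence m θ i j
    rw [← hsum] at hrec
    have hTB : (triMat m * B) i j = 2 / s / D * ∑ k, triMat m i k * green m θ k j := by
      rw [Matrix.mul_apply, Finset.mul_sum]
      refine Finset.sum_congr rfl fun k _ => ?_
      simp only [B, Matrix.of_apply]
      ring
    rw [hM, sub_mul, Matrix.smul_mul, Matrix.smul_mul, one_mul, Matrix.sub_apply,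
      Matrix.smul_apply, Matrix.smul_apply, hTB, smul_eq_mul, smul_eq_mul, ← h, Matrix.one_apply]
    simp only [B, Matrix.of_apply]
    have hij : ((i : ℤ) = j) ↔ i = j := by rw [Fin.ext_iff]; omega
    simp only [hij] at hrec
    have : (if i = j then (1 : ℝ) else 0) = (if i = j then D else 0) / D := by
      split_ifs <;> simp [hDpos.ne']
    rw [this, hD, ← hrec, ← hD]
    field_simp
  have hBM : B * M = 1 := mul_eq_one_comm.1 hMB
  have hN : (1 - s) • (1 : Matrix (Fin m) (Fin m) ℝ) + (s / 2) • triMat m = (2 : ℝ) • 1 - M := by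
    rw [hM]
    module
  rw [cnMat, ← hM, Matrix.inv_eq_right_inv hMB, hN, mul_sub, hBM, Matrix.mul_smul, mul_one,
    Matrix.sub_apply, Matrix.smul_apply, Matrix.one_apply, smul_eq_mul]
  simp only [B, Matrix.of_apply]
  ring

theorem green_nonneg {m : ℕ} {θ : ℝ} (hθ : 0 < θ) (i j : Fin m) : 0 ≤ green m θ i j := by
  have hi := i.isLt
  have hj := j.isLt
  have h1 : (0 : ℤ) ≤ min (i : ℤ) j + 1 := by omega
  have h2 : (0 : ℤ) ≤ m - max (i : ℤ) j := by omega
  refine mul_nonneg (Real.sinh_nonneg_iff.2 ?_) (Real.sinh_nonneg_iff.2 ?_)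
  · exact mul_nonneg (by exact_mod_cast h1) hθ.le
  · exact mul_nonneg (by exact_mod_cast h2) hθ.le

theorem sinh_mul_sinh_le_green_self {m : ℕ} {θ : ℝ} (hθ : 0 < θ) (i : Fin m) :
    Real.sinh θ * Real.sinh (m * θ) ≤ green m θ i i := by
  have hi : ((i : ℕ) : ℝ) + 1 ≤ m := by exact_mod_cast i.isLt
  have h := sinh_mul_sinh_sub ((i : ℕ) * θ) ((m - 1 - (i : ℕ)) * θ) θ
  rw [show ((i : ℕ) : ℝ) * θ + (m - 1 - (i : ℕ)) * θ + θ = m * θ by ring,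
    show ((i : ℕ) : ℝ) * θ + θ = ((i : ℕ) + 1) * θ by ring,
    show ((m : ℝ) - 1 - (i : ℕ)) * θ + θ = (m - (i : ℕ)) * θ by ring] at h
  have h1 : 0 ≤ Real.sinh ((i : ℕ) * θ) := Real.sinh_nonneg_iff.2 (by positivity)
  have h2 : 0 ≤ Real.sinh ((m - 1 - (i : ℕ)) * θ) :=
    Real.sinh_nonneg_iff.2 (mul_nonneg (by linarith) hθ.le)
  have := mul_nonneg h1 h2
  simp only [green, min_self, max_self]
  push_cast
  linarith

theorem cnMat_nonneg_iff {m : ℕ} (hm : 1 ≤ m) {s θ : ℝ} (hs : 0 < s) (hθ : 0 < θ)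
    (h : s * Real.cosh θ = 1 + s) :
    (∀ i j, 0 ≤ cnMat m s i j) ↔ coth (m * θ) * Real.sinh θ ≤ 3 * Real.cosh θ - 4 := by
  have hm' : (0 : ℝ) < m := by exact_mod_cast hm
  have hS := Real.sinh_pos_iff.2 (mul_pos hm' hθ)
  have hS1 := Real.sinh_pos_iff.2 hθ
  have hSm : 0 < Real.sinh ((m + 1) * θ) := Real.sinh_pos_iff.2 (by positivity)
  have hD := mul_pos hS1 hSm
  have hs' : 4 / s = 4 * (Real.cosh θ - 1) := by
    field_simp
    linarith
  have key : coth (m * θ) * Real.sinh θ ≤ 3 * Real.cosh θ - 4 ↔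
      Real.sinh ((m + 1) * θ) ≤ 4 / s * Real.sinh (m * θ) := by
    rw [hs', coth, div_mul_eq_mul_div, div_le_iff₀ hS, add_mul, one_mul, Real.sinh_add]
    constructor <;> intro _ <;> linarith
  rw [key]
  constructor
  · intro hA
    have h0 := hA ⟨0, hm⟩ ⟨0, hm⟩
    rw [cnMat_apply m hs hθ h, if_pos rfl, sub_nonneg, one_le_div hD] at h0
    simp only [green, min_self, max_self] at h0
    push_cast at h0
    rw [one_mul, sub_zero] at h0
    refine le_of_mul_le_mul_left ?_ hS1
    linarith
  · intro hle i j
    have hs4 : 0 < 4 / s := by positivity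
    rw [cnMat_apply m hs hθ h]
    split_ifs with hij
    · subst hij
      rw [sub_nonneg, one_le_div hD]
      calc _ ≤ Real.sinh θ * (4 / s * Real.sinh (m * θ)) := mul_le_mul_of_nonneg_left hle hS1.le
        _ = 4 / s * (Real.sinh θ * Real.sinh (m * θ)) := by ring
        _ ≤ _ := mul_le_mul_of_nonneg_left (sinh_mul_sinh_le_green_self hθ i) hs4.le
    · rw [sub_zero]
      exact div_nonneg (mul_nonneg hs4.le (green_nonneg hθ i j)) hD.le

theorem stmt1 (m : ℕ) (hm : 1 ≤ m) (ω : ℝ) (hω : 0 < ω) (heq : cothEq m ω) :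
    ∀ s : ℝ, 0 < s →
      ((∀ i j, 0 ≤ cnMat m s i j) ↔ s ≤ 1 / (Real.cosh ω - 1)) := by
  intro s hs
  have h1 : 1 < 1 + 1 / s := by
    have : 0 < 1 / s := by positivity
    linarith
  obtain ⟨θ, hθ, hc⟩ : ∃ θ, 0 < θ ∧ Real.cosh θ = 1 + 1 / s :=
    ⟨Real.arcosh (1 + 1 / s), Real.arcosh_pos h1, Real.cosh_arcosh h1.le⟩
  have h : s * Real.cosh θ = 1 + s := by
    rw [hc]
    field_simp
    ring
  have hmono : ω ≤ θ ↔ Real.cosh ω ≤ Real.cosh θ := by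
    rw [Real.cosh_le_cosh, abs_of_pos hω, abs_of_pos hθ]
  rw [cnMat_nonneg_iff hm hs hθ h, coth_mul_sinh_le_iff hm hω hθ heq, hmono, hc,
    le_one_div hs (cosh_sub_one_pos hω)]
  constructor <;> intro _ <;> linarith
end
end

section
/- For each integer m ≥ 1 let ω_m denote the unique positive root of the equation (cosh(m·ω)/sinh(m·ω))·sinh(ω) = 3·cosh(ω) − 4, and set s_m = 1/(cosh(ω_m) − 1). Then the sequence (s_m) is strictly increasing, i.e. s_m < s_{m+1} for all m ≥ 1, and 1 ≤ s_m < 4 − 2√2 for all m ≥ 1. -/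
open Real Matrix Filter

noncomputable section

theorem cosh_div_sinh_lt {x y : ℝ} (hx : 0 < x) (hxy : x < y) :
    Real.cosh y / Real.sinh y < Real.cosh x / Real.sinh x := by
  have hsx := Real.sinh_pos_iff.2 hx
  have hsy := Real.sinh_pos_iff.2 (hx.trans hxy)
  rw [div_lt_div_iff₀ hsy hsx]
  have h := Real.sinh_pos_iff.2 (sub_pos.2 hxy)
  rw [Real.sinh_sub] at h
  linarith

theorem three_cosh_sub_four_div_sinh_le {a b : ℝ} (ha : 0 < a) (hab : a ≤ b) :
    (3 * Real.cosh a - 4) / Real.sinh a ≤ (3 * Real.cosh b - 4) / Real.sinh b := by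
  rw [div_le_div_iff₀ (Real.sinh_pos_iff.2 ha) (Real.sinh_pos_iff.2 (ha.trans_le hab))]
  obtain ⟨p, q, rfl, rfl⟩ : ∃ p q, a = p - q ∧ b = p + q :=
    ⟨(a + b) / 2, (b - a) / 2, by ring, by ring⟩
  have hq : 0 ≤ q := by linarith
  have hc : Real.cosh q ≤ Real.cosh p :=
    Real.cosh_le_cosh.2 (by rw [abs_of_nonneg hq, abs_of_nonneg (by linarith)]; linarith)
  have hpos : 0 ≤ Real.sinh q * (8 * Real.cosh p - 6 * Real.cosh q) :=
    mul_nonneg (Real.sinh_nonneg_iff.2 hq) (by linarith [Real.cosh_pos q])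
  rw [Real.cosh_sub, Real.cosh_add, Real.sinh_sub, Real.sinh_add]
  linear_combination hpos +
    6 * Real.sinh q * Real.cosh q * Real.cosh_sq_sub_sinh_sq p

theorem cothEq.cosh_div_sinh_eq {m : ℕ} {x : ℝ} (hx : 0 < x) (h : cothEq m x) :
    Real.cosh (m * x) / Real.sinh (m * x) = (3 * Real.cosh x - 4) / Real.sinh x :=
  (eq_div_iff (Real.sinh_pos_iff.2 hx).ne').2 h

theorem cothEq.root_lt_of_succ {m : ℕ} (hm : 1 ≤ m) {a b : ℝ} (ha : 0 < a) (hb : 0 < b)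
    (hma : cothEq m a) (hmb : cothEq (m + 1) b) : b < a := by
  by_contra! hab
  have hm' : (1 : ℝ) ≤ m := by exact_mod_cast hm
  have h := three_cosh_sub_four_div_sinh_le ha hab
  rw [← hma.cosh_div_sinh_eq ha, ← hmb.cosh_div_sinh_eq hb] at h
  refine (cosh_div_sinh_lt (by positivity) ?_).not_ge h
  push_cast
  nlinarith

theorem cothEq.lt_cosh {m : ℕ} (hm : 1 ≤ m) {x : ℝ} (hx : 0 < x) (h : cothEq m x) :
    (6 + √2) / 4 < Real.cosh x := by
  have hm' : (1 : ℝ) ≤ m := by exact_mod_cast hm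
  have hs := Real.sinh_pos_iff.2 hx
  have hcoth : 1 < Real.cosh (m * x) / Real.sinh (m * x) :=
    (one_lt_div (Real.sinh_pos_iff.2 (by positivity))).2 (Real.sinh_lt_cosh _)
  have hlt : Real.sinh x < 3 * Real.cosh x - 4 := by
    rw [← h]
    exact lt_mul_of_one_lt_left hs hcoth
  have hsq : Real.sinh x ^ 2 < (3 * Real.cosh x - 4) ^ 2 := by gcongr
  have h2 : √2 ^ 2 = 2 := Real.sq_sqrt (by norm_num)
  have h2' : 1 < √2 := by nlinarith [Real.sqrt_nonneg 2]
  by_contra! hle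
  nlinarith [Real.cosh_sq x, mul_nonneg (sub_nonneg.2 hle)
    (show 0 ≤ Real.cosh x - (6 - √2) / 4 by linarith)]

theorem cosh_eq_two_of_cothEq_one {x : ℝ} (hx : 0 < x) (h : cothEq 1 x) :
    Real.cosh x = 2 := by
  have hs := (Real.sinh_pos_iff.2 hx).ne'
  rw [cothEq, Nat.cast_one, one_mul, div_mul_cancel₀ _ hs] at h
  linarith

theorem stmt2 (ω : ℕ → ℝ)
    (hroot : ∀ m, 1 ≤ m → 0 < ω m ∧ cothEq m (ω m))
    (huniq : ∀ m, 1 ≤ m → ∀ ω' : ℝ, 0 < ω' → cothEq m ω' → ω' = ω m) :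
    (∀ m, 1 ≤ m →
        1 / (Real.cosh (ω m) - 1) < 1 / (Real.cosh (ω (m + 1)) - 1)) ∧
      ∀ m, 1 ≤ m →
        1 ≤ 1 / (Real.cosh (ω m) - 1) ∧
          1 / (Real.cosh (ω m) - 1) < 4 - 2 * Real.sqrt 2 := by
  have hlt : ∀ m, 1 ≤ m → Real.cosh (ω (m + 1)) < Real.cosh (ω m) := fun m hm => by
    obtain ⟨ha, hma⟩ := hroot m hm
    obtain ⟨hb, hmb⟩ := hroot (m + 1) (by omega)
    rw [Real.cosh_lt_cosh, abs_of_pos ha, abs_of_pos hb]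
    exact cothEq.root_lt_of_succ hm ha hb hma hmb
  have hpos : ∀ m, 1 ≤ m → 0 < Real.cosh (ω m) - 1 := fun m hm =>
    sub_pos.2 (Real.one_lt_cosh.2 (hroot m hm).1.ne')
  have hle : ∀ m, 1 ≤ m → Real.cosh (ω m) ≤ 2 := fun m hm => by
    induction m, hm using Nat.le_induction with
    | base => exact (cosh_eq_two_of_cothEq_one (hroot 1 le_rfl).1 (hroot 1 le_rfl).2).le
    | succ n hn ih => exact (hlt n hn).le.trans ih
  refine ⟨fun m hm => one_div_lt_one_div_of_lt (hpos (m + 1) (by omega)) (by linarith [hlt m hm]),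
    fun m hm => ⟨(one_le_div (hpos m hm)).2 (by linarith [hle m hm]), ?_⟩⟩
  have hc := (hroot m hm).2.lt_cosh hm (hroot m hm).1
  have h2 : √2 ^ 2 = 2 := Real.sq_sqrt (by norm_num)
  have h2' : √2 < 2 := by nlinarith [Real.sqrt_nonneg 2]
  rw [div_lt_iff₀ (hpos m hm)]
  nlinarith [mul_pos (sub_pos.2 hc) (sub_pos.2 h2')]
end
end

section
/- For each integer m ≥ 1 let ω_m denote the unique positive root of the equation (cosh(m·ω)/sinh(m·ω))·sinh(ω) = 3·cosh(ω) − 4. Then the sequence (ω_m) converges to log(2 + √2), and consequently the sequence s_m = 1/(cosh(ω_m) − 1) converges to 4 − 2√2. -/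
open Real Matrix Filter

noncomputable section

/-- With `x = exp ω`, the equation `cothEq m ω` becomes polynomial. -/
lemma cothEq.exp_eq {m : ℕ} {ω : ℝ} (hm : 1 ≤ m) (hω : 0 < ω) (h : cothEq m ω) :
    (exp ω ^ 2 - 4 * exp ω + 2) * (exp ω ^ m) ^ 2 = 2 * exp ω ^ 2 - 4 * exp ω + 1 := by
  have hx : 0 < exp ω := exp_pos ω
  have hX : 1 < exp ω ^ m := one_lt_pow₀ (one_lt_exp_iff.2 hω) (by lia)
  unfold cothEq at h
  rw [Real.cosh_eq, Real.sinh_eq, Real.cosh_eq, Real.sinh_eq, Real.exp_neg, Real.exp_neg,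
    Real.exp_nat_mul] at h
  generalize exp ω ^ m = X at hX h ⊢
  generalize exp ω = x at hx h ⊢
  have hd : X ^ 2 - 1 ≠ 0 := by nlinarith
  have hX0 : X ≠ 0 := by positivity
  have hcoth : (X + X⁻¹) / 2 / ((X - X⁻¹) / 2) = (X ^ 2 + 1) / (X ^ 2 - 1) := by
    have hd' : X - X⁻¹ ≠ 0 := by
      intro h0
      apply hd
      field_simp at h0
      linarith
    field_simp
  rw [hcoth] at h
  field_simp at h
  linarith

/-- The exponential of a root lies above `2 + √2`, at a distance that decays geometrically. -/
lemma cothEq.exp_bounds {n : ℕ} {ω : ℝ} (hω : 0 < ω) (h : cothEq (n + 1 : ℕ) ω) :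
    2 + √2 ≤ exp ω ∧ exp ω ≤ 2 + √2 + 2 * (1 / 9) ^ n := by
  have key := h.exp_eq (Nat.le_add_left 1 n) hω
  have hx : 1 < exp ω := one_lt_exp_iff.2 hω
  generalize exp ω = x at hx key ⊢
  have hs : √2 ^ 2 = 2 := Real.sq_sqrt (by norm_num)
  have hs1 : 1 < √2 := Real.lt_sqrt_of_sq_lt (by norm_num)
  have hpos : 0 < x ^ 2 - 4 * x + 2 := by
    have hX : x ^ 2 ≤ (x ^ (n + 1)) ^ 2 := by
      gcongr
      exact le_self_pow₀ hx.le (Nat.succ_ne_zero n)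
    by_contra! hneg
    have h1 : 2 * x ^ 2 - 4 * x + 1 ≤ (x ^ 2 - 4 * x + 2) * x ^ 2 := by
      rw [← key]
      exact mul_le_mul_of_nonpos_left hX hneg
    nlinarith [mul_pos (show 0 < x ^ 2 - 1 by nlinarith) (show 0 < -(x ^ 2 - 4 * x + 1) by linarith)]
  have hlow : 2 + √2 ≤ x := by
    by_contra! hlt
    nlinarith [mul_pos (sub_pos.2 hlt) (show 0 < x - (2 - √2) by linarith)]
  refine ⟨hlow, ?_⟩
  have hY9 : 9 ^ n ≤ (x ^ n) ^ 2 := by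
    rw [← pow_mul, mul_comm, pow_mul]
    gcongr
    nlinarith
  have hbound : (x ^ 2 - 4 * x + 2) * 9 ^ n ≤ 2 := by
    have h1 : (x ^ 2 - 4 * x + 2) * (x ^ n) ^ 2 * x ^ 2 ≤ 2 * x ^ 2 := by
      rw [pow_succ x n, mul_pow, ← mul_assoc] at key
      linarith
    have h2 := le_of_mul_le_mul_right h1 (by positivity)
    nlinarith
  have hdist : (x - (2 + √2)) * 9 ^ n ≤ 2 := by
    refine le_trans ?_ hbound
    gcongr
    nlinarith
  rw [one_div, inv_pow, ← div_eq_mul_inv, ← sub_le_iff_le_add', le_div_iff₀ (by positivity)]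
  exact hdist

theorem stmt3 (ω : ℕ → ℝ)
    (hroot : ∀ m, 1 ≤ m → 0 < ω m ∧ cothEq m (ω m))
    (huniq : ∀ m, 1 ≤ m → ∀ ω' : ℝ, 0 < ω' → cothEq m ω' → ω' = ω m) :
    Filter.Tendsto ω Filter.atTop (nhds (Real.log (2 + Real.sqrt 2))) ∧
      Filter.Tendsto (fun m => 1 / (Real.cosh (ω m) - 1)) Filter.atTop
        (nhds (4 - 2 * Real.sqrt 2)) := by
  have hexp : Tendsto (fun n => exp (ω (n + 1))) atTop (nhds (2 + √2)) := by
    have hb n := (hroot (n + 1) (Nat.le_add_left 1 n)).2.exp_bounds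
      (hroot (n + 1) (Nat.le_add_left 1 n)).1
    refine tendsto_of_tendsto_of_tendsto_of_le_of_le tendsto_const_nhds ?_
      (fun n => (hb n).1) (fun n => (hb n).2)
    simpa using ((tendsto_pow_atTop_nhds_zero_of_lt_one (r := (1 / 9 : ℝ)) (by norm_num)
      (by norm_num)).const_mul 2).const_add (2 + √2)
  have hpos : 0 < 2 + √2 := by positivity
  have hlim : Tendsto ω atTop (nhds (log (2 + √2))) := by
    rw [← tendsto_add_atTop_iff_nat 1]
    simpa using hexp.log hpos.ne'
  refine ⟨hlim, ?_⟩
  have hs : √2 ^ 2 = 2 := Real.sq_sqrt (by norm_num)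
  have hcosh : cosh (log (2 + √2)) - 1 = (2 + √2) / 4 := by
    rw [Real.cosh_log hpos]
    field_simp
    linarith
  have hval : 4 - 2 * √2 = 1 / (cosh (log (2 + √2)) - 1) := by
    rw [hcosh]
    field_simp
    linarith
  rw [hval]
  refine Tendsto.div tendsto_const_nhds
    (((Real.continuous_cosh.tendsto _).comp hlim).sub_const 1) ?_
  rw [hcosh]
  positivity
end
end

section
/- For every integer m with 1 ≤ m ≤ 3 and every real s > 0, the Crank–Nicolson matrix satisfies ‖A_m(s)‖_∞ ≤ 1. -/
open Real Matrix Filter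

noncomputable section

lemma cnMat_eq_of_mul_eq_one {m : ℕ} {s : ℝ} {B : Matrix (Fin m) (Fin m) ℝ}
    (h : ((1 + s) • (1 : Matrix (Fin m) (Fin m) ℝ) - (s / 2) • triMat m) * B = 1) :
    cnMat m s = (2 : ℝ) • B - 1 := by
  have hK : (1 - s) • (1 : Matrix (Fin m) (Fin m) ℝ) + (s / 2) • triMat m =
      (2 : ℝ) • 1 - ((1 + s) • (1 : Matrix (Fin m) (Fin m) ℝ) - (s / 2) • triMat m) := by
    module
  rw [cnMat, Matrix.inv_eq_right_inv h, hK, mul_sub, mul_eq_one_comm.mp h, Matrix.mul_smul,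
    mul_one]

lemma maxNorm_cnMat_one_le {s : ℝ} (hs : 0 < s) : maxNorm (cnMat 1 s) ≤ 1 := by
  have hp : 0 < 1 + s := by positivity
  rw [cnMat_eq_of_mul_eq_one (B := !![1 / (1 + s)])]
  · refine ciSup_le fun i => ?_
    have h : 2 * (1 / (1 + s)) - 1 = (1 - s) / (1 + s) := by field_simp; ring
    fin_cases i
    simp only [Fin.sum_univ_one, Matrix.sub_apply, Matrix.smul_apply, smul_eq_mul,
      Matrix.one_apply, Fin.isValue, Fin.zero_eta, of_apply, cons_val', cons_val_fin_one,
      if_true]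
    rw [h, abs_div, abs_of_pos hp, div_le_one hp, abs_le]
    constructor <;> linarith
  · ext i j
    fin_cases i
    fin_cases j
    simp [triMat, Matrix.mul_apply]
    field_simp

lemma maxNorm_cnMat_two_le {s : ℝ} (hs : 0 < s) : maxNorm (cnMat 2 s) ≤ 1 := by
  obtain ⟨D, hD⟩ : ∃ D, D = (1 + s) ^ 2 - (s / 2) ^ 2 := ⟨_, rfl⟩
  have hD0 : 0 < D := by rw [hD]; nlinarith
  have hD' : D ≠ 0 := hD0.ne'
  rw [cnMat_eq_of_mul_eq_one (B := !![(1 + s) / D, s / 2 / D; s / 2 / D, (1 + s) / D])]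
  · have h : |2 * ((1 + s) / D) - 1| + |2 * (s / 2 / D)| ≤ 1 := by
      have h1 : 2 * ((1 + s) / D) - 1 = (2 * (1 + s) - D) / D := by field_simp
      have h2 : 2 * (s / 2 / D) = s / D := by field_simp
      rw [h1, h2, abs_div, abs_div, abs_of_pos hD0, abs_of_pos hs, ← add_div, div_le_one hD0,
        ← le_sub_iff_add_le, abs_le]
      constructor <;> nlinarith
    refine ciSup_le fun i => ?_
    fin_cases i
    · simpa [Fin.sum_univ_two] using h
    · simpa [Fin.sum_univ_two, add_comm] using h
  · ext i j
    fin_cases i <;> fin_cases j <;>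
      simp [triMat, Matrix.mul_apply, Fin.sum_univ_two] <;> field_simp <;> rw [hD] <;> ring

lemma maxNorm_cnMat_three_le {s : ℝ} (hs : 0 < s) : maxNorm (cnMat 3 s) ≤ 1 := by
  obtain ⟨p, hp⟩ : ∃ p, p = 1 + s := ⟨_, rfl⟩
  obtain ⟨q, hq⟩ : ∃ q, q = s / 2 := ⟨_, rfl⟩
  obtain ⟨D, hD⟩ : ∃ D, D = p * (p ^ 2 - 2 * q ^ 2) := ⟨_, rfl⟩
  have hp0 : 0 < p := by rw [hp]; positivity
  have hq0 : 0 < q := by rw [hq]; positivity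
  have hpq : 0 < p - 2 * q := by rw [hp, hq]; linarith
  have hE : p + 2 * q ≤ p ^ 2 - 2 * q ^ 2 := by rw [hp, hq]; nlinarith
  have hpE : p * (p + 2 * q) ≤ D := hD ▸ mul_le_mul_of_nonneg_left hE hp0.le
  have hD0 : 0 < D := lt_of_lt_of_le (by positivity) hpE
  have hD' : D ≠ 0 := hD0.ne'
  have hpq0 : 0 < p * q := mul_pos hp0 hq0
  rw [cnMat_eq_of_mul_eq_one (B := !![(p ^ 2 - q ^ 2) / D, p * q / D, q ^ 2 / D;
    p * q / D, p ^ 2 / D, p * q / D; q ^ 2 / D, p * q / D, (p ^ 2 - q ^ 2) / D])]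
  · have hrow {x y : ℝ} (hy : 0 < y) (h1 : x + y ≤ D) (h2 : y ≤ x) :
        |2 * (x / D) - 1| + 2 * (y / D) ≤ 1 := by
      have e1 : 2 * (x / D) - 1 = (2 * x - D) / D := by field_simp
      rw [e1, abs_div, abs_of_pos hD0, ← mul_div_assoc, ← add_div, div_le_one hD0,
        ← le_sub_iff_add_le, abs_le]
      constructor <;> linarith
    have houter := hrow (x := p ^ 2 - q ^ 2) (y := p * q + q ^ 2) (by positivity)
      (by nlinarith) (by nlinarith [mul_pos hpq (add_pos hp0 hq0)])
    have hmid := hrow (x := p ^ 2) (y := 2 * (p * q)) (by positivity)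
      (by nlinarith) (by nlinarith)
    have a1 : |p * q / D| = p * q / D := abs_of_pos (by positivity)
    have a2 : |q ^ 2 / D| = q ^ 2 / D := abs_of_pos (by positivity)
    refine ciSup_le fun i => ?_
    fin_cases i <;>
      simp only [Fin.sum_univ_three, Matrix.sub_apply, Matrix.smul_apply, smul_eq_mul,
        Matrix.one_apply] <;>
      simp [-abs_mul, -abs_pow] <;>
      simp only [abs_mul (2 : ℝ), a1, a2, abs_two]
    · rw [add_div] at houter; linarith
    · rw [mul_div_assoc] at hmid; linarith
    · rw [add_div] at houter; linarith
  · rw [← hp, ← hq]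
    ext i j
    fin_cases i <;> fin_cases j <;>
      simp [triMat, Matrix.mul_apply, Fin.sum_univ_three] <;> field_simp <;>
      (rw [hD]; ring)

theorem stmt4 (m : ℕ) (hm1 : 1 ≤ m) (hm3 : m ≤ 3) (s : ℝ) (hs : 0 < s) :
    maxNorm (cnMat m s) ≤ 1 := by
  interval_cases m
  · exact maxNorm_cnMat_one_le hs
  · exact maxNorm_cnMat_two_le hs
  · exact maxNorm_cnMat_three_le hs
end
end

section
/- For each integer m ≥ 4 let ω_m be the unique positive root of the equation 2·sinh((m−1)·ω/4)·sinh((m+1)·ω/4) = sinh(ω/2)·sinh((m+1)·ω/2) if m is odd, and of the equation sinh(ω/2)²·sinh(m·ω/2)·(sinh((m+2)·ω/2) − sinh(m·ω/2)) = sinh(ω)·sinh((m+1)·ω/2)·sinh(m·ω/4)·sinh((m−2)·ω/4) if m is even, and set s_m = 1/(cosh(ω_m) − 1). Then the sequence (s_m)_{m ≥ 4} is strictly decreasing, i.e. s_{m+1} < s_m for all m ≥ 4, and 3/2 < s_m ≤ 1 + √5 for all m ≥ 4. -/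
open Real Matrix Filter

noncomputable section

/-- Addition formula for `tanh`, in denominator-free form. -/
theorem tanh_add_mul (x y : ℝ) :
    tanh (x + y) * (1 + tanh x * tanh y) = tanh x + tanh y := by
  have hx := (cosh_pos x).ne'
  have hy := (cosh_pos y).ne'
  have hxy := (cosh_pos (x + y)).ne'
  rw [cosh_add, mul_comm (cosh x)] at hxy
  simp only [tanh_eq_sinh_div_cosh, sinh_add, cosh_add, mul_comm (cosh x) (cosh y)]
  field_simp

theorem tanh_pos_of_pos {x : ℝ} (hx : 0 < x) : 0 < tanh x := by
  rw [tanh_eq_sinh_div_cosh]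
  exact div_pos (sinh_pos_iff.2 hx) (cosh_pos x)

theorem tanh_lt_tanh_of_lt {x y : ℝ} (h : x < y) : tanh x < tanh y := by
  rw [tanh_eq_sinh_div_cosh, tanh_eq_sinh_div_cosh, div_lt_div_iff₀ (cosh_pos x) (cosh_pos y)]
  have := sinh_pos_iff.2 (sub_pos.2 h)
  rw [sinh_sub] at this
  linarith

/-- The ratio `tanh (n * x) / tanh x` is nonincreasing in `x > 0`. -/
theorem tanh_nat_mul_mul_tanh_le (n : ℕ) {x y : ℝ} (hy : 0 < y) (hyx : y ≤ x) :
    tanh (n * x) * tanh y ≤ tanh (n * y) * tanh x := by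
  have hx : 0 < x := hy.trans_le hyx
  have hT := tanh_pos_of_pos hx
  have hS := tanh_pos_of_pos hy
  have hS1 := tanh_lt_one y
  have hST : tanh y ≤ tanh x := by
    rcases hyx.eq_or_lt with h | h
    · rw [h]
    · exact (tanh_lt_tanh_of_lt h).le
  have nonneg : ∀ (k : ℕ) {z : ℝ}, 0 < z → 0 ≤ tanh (k * z) := by
    intro k z hz
    rcases k.eq_zero_or_pos with rfl | hk
    · simp
    · exact (tanh_pos_of_pos (by positivity)).le
  induction n with
  | zero => simp
  | succ n ih =>
    have hp := nonneg n hx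
    have hq := nonneg n hy
    have ep := tanh_add_mul (n * x) x
    have eq := tanh_add_mul (n * y) y
    push_cast
    rw [add_one_mul, add_one_mul]
    generalize tanh (n * x + x) = p' at *
    generalize tanh (n * y + y) = q' at *
    generalize tanh (n * x) = p at *
    generalize tanh (n * y) = q at *
    generalize tanh x = T at *
    generalize tanh y = S at *
    have dp : 0 < 1 + p * T := by positivity
    have dq : 0 < 1 + q * S := by positivity
    rw [eq_div_of_mul_eq dp.ne' ep, eq_div_of_mul_eq dq.ne' eq, div_mul_eq_mul_div,
      div_mul_eq_mul_div, div_le_div_iff₀ dp dq]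
    have h1 : 0 ≤ (q * T - p * S) * (1 - S ^ 2) :=
      mul_nonneg (by linarith) (by nlinarith)
    have h2 : 0 ≤ p * q * (T ^ 2 - S ^ 2) := mul_nonneg (by positivity) (by nlinarith)
    have h3 : 0 ≤ p * S * (T ^ 2 - S ^ 2) := mul_nonneg (by positivity) (by nlinarith)
    nlinarith

/-- If `tanh (n x) / tanh x` exceeds `tanh (n y) / tanh y`, then `x < y`. -/
theorem lt_of_tanh_nat_mul_mul_tanh_lt (n : ℕ) {x y : ℝ} (hy : 0 < y)
    (h : tanh (n * y) * tanh x < tanh (n * x) * tanh y) : x < y := by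
  by_contra! hle
  exact absurd (tanh_nat_mul_mul_tanh_le n hy hle) (not_le.2 h)

theorem oddEq.tanh_eq {a : ℕ} {ω : ℝ} (hω : 0 < ω) (h : oddEq (2 * a + 1) ω) :
    tanh ((a + 1 : ℕ) * (ω / 2)) = 2 * tanh (ω / 2) := by
  unfold oddEq at h
  obtain ⟨x, rfl⟩ : ∃ x, ω = 2 * x := ⟨ω / 2, by ring⟩
  have e1 : (((2 * a + 1 : ℕ) : ℝ) - 1) * (2 * x) / 4 = ((a + 1 : ℕ) * x) - x := by
    push_cast; ring
  have e2 : (((2 * a + 1 : ℕ) : ℝ) + 1) * (2 * x) / 4 = (a + 1 : ℕ) * x := by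
    push_cast; ring
  have e3 : (((2 * a + 1 : ℕ) : ℝ) + 1) * (2 * x) / 2 = 2 * ((a + 1 : ℕ) * x) := by
    push_cast; ring
  have e4 : 2 * x / 2 = x := by ring
  rw [e1, e2, e3, e4, sinh_two_mul, sinh_sub] at h
  rw [e4]
  have hz : 0 < ((a + 1 : ℕ) : ℝ) * x := mul_pos (by positivity) (by linarith)
  generalize ((a + 1 : ℕ) : ℝ) * x = z at *
  have hs := (sinh_pos_iff.2 hz).ne'
  have := (cosh_pos x).ne'
  have := (cosh_pos z).ne'
  rw [tanh_eq_sinh_div_cosh, tanh_eq_sinh_div_cosh]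
  field_simp
  apply mul_left_cancel₀ hs
  linear_combination h / 2

theorem evenEq.tanh_eq {k : ℕ} (hk : 0 < k) {ω : ℝ} (hω : 0 < ω) (h : evenEq (2 * k) ω) :
    2 * tanh (ω / 2) ^ 2 =
      tanh (k * (ω / 2) + (k + 1 : ℕ) * (ω / 2)) * (tanh (k * (ω / 2)) - tanh (ω / 2)) := by
  unfold evenEq at h
  obtain ⟨x, rfl⟩ : ∃ x, ω = 2 * x := ⟨ω / 2, by ring⟩
  have e1 : ((2 * k : ℕ) : ℝ) * (2 * x) / 2 = 2 * (k * x) := by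
    push_cast; ring
  have e2 : (((2 * k : ℕ) : ℝ) + 2) * (2 * x) / 2 = (k * x + (k + 1 : ℕ) * x) + x := by
    push_cast; ring
  have e2' : 2 * (k * x) = (k * x + (k + 1 : ℕ) * x) - x := by
    push_cast; ring
  have e3 : (((2 * k : ℕ) : ℝ) + 1) * (2 * x) / 2 = k * x + (k + 1 : ℕ) * x := by
    push_cast; ring
  have e4 : 2 * x / 2 = x := by ring
  have e5 : ((2 * k : ℕ) : ℝ) * (2 * x) / 4 = k * x := by
    push_cast; ring
  have e6 : (((2 * k : ℕ) : ℝ) - 2) * (2 * x) / 4 = k * x - x := by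
    push_cast; ring
  have hd : sinh (k * x + (k + 1 : ℕ) * x + x) - sinh (2 * (k * x)) =
      2 * cosh (k * x + (k + 1 : ℕ) * x) * sinh x := by
    rw [e2', sinh_add, sinh_sub]; ring
  rw [e1, e2, e3, e4, e5, e6, hd, sinh_two_mul, sinh_two_mul, sinh_sub] at h
  rw [e4]
  have hx : 0 < x := by linarith
  have hz : 0 < (k : ℝ) * x := by positivity
  generalize (k : ℝ) * x + (k + 1 : ℕ) * x = w at *
  generalize (k : ℝ) * x = z at *
  have hs := (sinh_pos_iff.2 hz).ne'
  have hs' := (sinh_pos_iff.2 hx).ne'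
  have := (cosh_pos x).ne'
  have := (cosh_pos z).ne'
  have := (cosh_pos w).ne'
  rw [tanh_eq_sinh_div_cosh, tanh_eq_sinh_div_cosh, tanh_eq_sinh_div_cosh]
  field_simp
  apply mul_left_cancel₀ hs
  apply mul_left_cancel₀ hs'
  linear_combination h / 2

theorem tanh_half_lt_half_of_oddEq {a : ℕ} {ω : ℝ} (hω : 0 < ω) (h : oddEq (2 * a + 1) ω) :
    tanh (ω / 2) < 1 / 2 := by
  have := tanh_lt_one ((a + 1 : ℕ) * (ω / 2))
  rw [h.tanh_eq hω] at this
  linarith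

theorem tanh_half_lt_half_of_evenEq {k : ℕ} (hk : 2 ≤ k) {ω : ℝ} (hω : 0 < ω)
    (h : evenEq (2 * k) ω) : tanh (ω / 2) < 1 / 2 := by
  have e := h.tanh_eq (by omega) hω
  have hk' : (2 : ℝ) ≤ k := by exact_mod_cast hk
  have h1 := tanh_lt_one (k * (ω / 2))
  have h2 := tanh_lt_one (k * (ω / 2) + (k + 1 : ℕ) * (ω / 2))
  have h3 : tanh (ω / 2) < tanh (k * (ω / 2)) := tanh_lt_tanh_of_lt (by nlinarith)
  have h0 := tanh_pos_of_pos (half_pos hω)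
  nlinarith [mul_pos (sub_pos.2 h2) (sub_pos.2 h3)]

/-- With `T = tanh x`, `τ = tanh (k x)`, `A = tanh ((k+1) x)`, `P = tanh ((2k+1) x)`. -/
theorem two_mul_lt_of_tanh_relations {T τ A P : ℝ} (hT : 0 < T) (hT2 : T < 1 / 2) (hτ : 0 < τ)
    (hA : A * (1 + τ * T) = τ + T) (hP : P * (1 + τ * A) = τ + A)
    (h : 2 * T ^ 2 = P * (τ - T)) : 2 * T < A := by
  by_contra! hle
  obtain ⟨r, rfl⟩ : ∃ r, τ = r * T := ⟨τ / T, by field_simp⟩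
  have hr : 0 < r := pos_of_mul_pos_left hτ hT.le
  have hr1 : r * (1 - 2 * T ^ 2) ≤ 1 := by
    have : r * T + T ≤ 2 * T * (1 + r * T * T) := by
      rw [← hA]; exact mul_le_mul_of_nonneg_right hle (by positivity)
    refine le_of_mul_le_mul_right ?_ hT
    linarith
  have hr2 : r < 2 := by nlinarith
  have key : (r + 1) * (T ^ 2 * r * (r - 4) + 2 * r - 3) = 0 := by
    have hc : T ^ 2 * ((r + 1) * (T ^ 2 * r * (r - 4) + 2 * r - 3)) = 0 := by
      have h' : 2 * T ^ 2 * (1 + r * T * A) = (r * T + A) * (r * T - T) := by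
        rw [← hP, h]; ring
      linear_combination (-(1 + r * T * T)) * h' + (2 * T ^ 2 * (r * T) - (r * T - T)) * hA
    exact (mul_eq_zero.1 hc).resolve_left (by positivity)
  have key' := (mul_eq_zero.1 key).resolve_left (by positivity)
  nlinarith [mul_nonneg (sub_nonneg.2 hr1) (by linarith : (0 : ℝ) ≤ 4 - r),
    mul_pos (sub_pos.2 hr2) hr]

theorem lt_of_evenEq_of_oddEq {k : ℕ} (hk : 2 ≤ k) {α β : ℝ} (hα : 0 < α) (hβ : 0 < β)
    (he : evenEq (2 * k) α) (ho : oddEq (2 * k + 1) β) : α < β := by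
  have h0 := tanh_pos_of_pos (half_pos hα)
  have hk' : (0 : ℝ) < k := by exact_mod_cast (by omega : 0 < k)
  have hA := tanh_add_mul (k * (α / 2)) (α / 2)
  rw [← add_one_mul, ← Nat.cast_add_one] at hA
  have key := two_mul_lt_of_tanh_relations h0 (tanh_half_lt_half_of_evenEq hk hα he)
    (tanh_pos_of_pos (mul_pos hk' (half_pos hα))) hA (tanh_add_mul _ _) (he.tanh_eq (by omega) hα)
  have : α / 2 < β / 2 := by
    refine lt_of_tanh_nat_mul_mul_tanh_lt (k + 1) (half_pos hβ) ?_
    rw [ho.tanh_eq hβ]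
    nlinarith [tanh_pos_of_pos (half_pos hβ)]
  linarith

theorem lt_of_oddEq_of_evenEq {a : ℕ} {α β : ℝ} (hα : 0 < α) (hβ : 0 < β)
    (ho : oddEq (2 * a + 1) α) (he : evenEq (2 * (a + 1)) β) : α < β := by
  have e := he.tanh_eq a.succ_pos hβ
  have h0 := tanh_pos_of_pos (half_pos hβ)
  have hP : tanh ((a + 1 : ℕ) * (β / 2)) <
      tanh ((a + 1 : ℕ) * (β / 2) + (a + 1 + 1 : ℕ) * (β / 2)) :=
    tanh_lt_tanh_of_lt (lt_add_of_pos_right _ (by positivity))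
  have key : tanh ((a + 1 : ℕ) * (β / 2)) < 2 * tanh (β / 2) := by
    by_contra! hle
    nlinarith
  have : α / 2 < β / 2 := by
    refine lt_of_tanh_nat_mul_mul_tanh_lt (a + 1) (half_pos hβ) ?_
    rw [ho.tanh_eq hα]
    nlinarith [tanh_pos_of_pos (half_pos hα)]
  linarith

theorem one_div_cosh_sub_one_eq {ω : ℝ} (hω : 0 < ω) :
    1 / (cosh ω - 1) = (1 / tanh (ω / 2) ^ 2 - 1) / 2 := by
  obtain ⟨x, rfl⟩ : ∃ x, ω = 2 * x := ⟨ω / 2, by ring⟩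
  have e : 2 * x / 2 = x := by ring
  have hs := (sinh_pos_iff.2 (by linarith : 0 < x)).ne'
  have hc := (cosh_pos x).ne'
  have h : cosh (2 * x) - 1 = 2 * sinh x ^ 2 := by
    rw [cosh_two_mul, cosh_sq]; ring
  rw [h, e, tanh_eq_sinh_div_cosh]
  field_simp
  rw [cosh_sq]; ring

theorem one_div_cosh_sub_one_lt {α β : ℝ} (hα : 0 < α) (h : α < β) :
    1 / (cosh β - 1) < 1 / (cosh α - 1) := by
  apply one_div_lt_one_div_of_lt
  · linarith [one_lt_cosh.2 hα.ne']
  · have : cosh α < cosh β := by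
      rw [cosh_lt_cosh, abs_of_pos hα, abs_of_pos (hα.trans h)]; exact h
    linarith

theorem one_div_cosh_sub_one_of_evenEq_four {ω : ℝ} (hω : 0 < ω) (h : evenEq 4 ω) :
    1 / (cosh ω - 1) = 1 + √5 := by
  have e := evenEq.tanh_eq (k := 2) two_pos hω h
  have h0 := tanh_pos_of_pos (half_pos hω)
  rw [one_div_cosh_sub_one_eq hω]
  have h2 := tanh_add_mul (ω / 2) (ω / 2)
  rw [← two_mul] at h2
  have h3 := tanh_add_mul (2 * (ω / 2)) (ω / 2)
  rw [show 2 * (ω / 2) + ω / 2 = 3 * (ω / 2) by ring] at h3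
  have h5 := tanh_add_mul (2 * (ω / 2)) (3 * (ω / 2))
  norm_num only at e h5
  generalize tanh (2 * (ω / 2) + 3 * (ω / 2)) = P at *
  generalize tanh (2 * (ω / 2)) = τ at *
  generalize tanh (3 * (ω / 2)) = A at *
  generalize tanh (ω / 2) = T at *
  have hτ : τ = 2 * T / (1 + T * T) := by rw [eq_div_iff (by positivity)]; linarith
  have hA : A = (3 * T + T ^ 3) / (1 + 3 * T ^ 2) := by
    rw [hτ] at h3
    field_simp at h3
    rw [eq_div_iff (by positivity)]
    linarith
  have h' : 2 * T ^ 2 * (1 + τ * A) = (τ + A) * (τ - T) := by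
    rw [← h5, e]; ring
  rw [hτ, hA] at h'
  field_simp at h'
  have hu : (T ^ 2 + 3) * (11 * (T ^ 2) ^ 2 + 6 * T ^ 2 - 1) = 0 := by
    linear_combination h'
  have hu' := (mul_eq_zero.1 hu).resolve_left (by positivity)
  have hs : √5 = (11 * T ^ 2 + 3) / 2 := by
    rw [Real.sqrt_eq_iff_mul_self_eq (by norm_num) (by positivity)]
    linear_combination (-(11 / 4)) * hu'
  rw [hs]
  field_simp
  linear_combination (-1) * hu'

theorem three_halves_lt_one_div_cosh_sub_one {ω : ℝ} (hω : 0 < ω) (h : tanh (ω / 2) < 1 / 2) :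
    3 / 2 < 1 / (cosh ω - 1) := by
  have h0 := tanh_pos_of_pos (half_pos hω)
  rw [one_div_cosh_sub_one_eq hω]
  have : 4 < 1 / tanh (ω / 2) ^ 2 := by
    rw [lt_div_iff₀ (by positivity)]
    nlinarith
  linarith

theorem stmt7 (ω : ℕ → ℝ)
    (hpos : ∀ m, 4 ≤ m → 0 < ω m)
    (hodd : ∀ m, 4 ≤ m → Odd m → oddEq m (ω m))
    (heven : ∀ m, 4 ≤ m → Even m → evenEq m (ω m))
    (huniq : ∀ m, 4 ≤ m → ∀ ω' : ℝ, 0 < ω' →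
        ((Odd m → oddEq m ω') ∧ (Even m → evenEq m ω')) → ω' = ω m) :
    (∀ m, 4 ≤ m →
        1 / (Real.cosh (ω (m + 1)) - 1) < 1 / (Real.cosh (ω m) - 1)) ∧
      ∀ m, 4 ≤ m →
        3 / 2 < 1 / (Real.cosh (ω m) - 1) ∧
          1 / (Real.cosh (ω m) - 1) ≤ 1 + Real.sqrt 5 := by
  have step : ∀ m, 4 ≤ m →
      1 / (Real.cosh (ω (m + 1)) - 1) < 1 / (Real.cosh (ω m) - 1) := by
    intro m hm
    have hα := hpos m hm
    have hβ := hpos (m + 1) (by omega)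
    refine one_div_cosh_sub_one_lt hα ?_
    rcases Nat.even_or_odd' m with ⟨k, rfl | rfl⟩
    · exact lt_of_evenEq_of_oddEq (by omega) hα hβ (heven _ hm (even_two_mul k))
        (hodd _ (by omega) (odd_two_mul_add_one k))
    · exact lt_of_oddEq_of_evenEq hα hβ (hodd _ hm (odd_two_mul_add_one k))
        (heven (2 * (k + 1)) (by omega) (even_two_mul _))
  refine ⟨step, fun m hm => ⟨?_, ?_⟩⟩
  · refine three_halves_lt_one_div_cosh_sub_one (hpos m hm) ?_
    rcases Nat.even_or_odd' m with ⟨k, rfl | rfl⟩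
    · exact tanh_half_lt_half_of_evenEq (by omega) (hpos _ hm) (heven _ hm (even_two_mul k))
    · exact tanh_half_lt_half_of_oddEq (hpos _ hm) (hodd _ hm (odd_two_mul_add_one k))
  · induction m, hm using Nat.le_induction with
    | base =>
      exact (one_div_cosh_sub_one_of_evenEq_four (hpos 4 le_rfl)
        (heven 4 le_rfl (by decide))).le
    | succ m hm ih => exact (step m hm).le.trans ih
end
end

section
/- For every real s > 0, the Crank–Nicolson matrix satisfies ‖A_m(s)‖_∞ ≤ 1 for every integer m ≥ 1 if and only if s ≤ 3/2. -/
open Real Matrix Filter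

noncomputable section

/-- The matrix inverted in the definition of `cnMat`. -/
def cnDenom (m : ℕ) (s : ℝ) : Matrix (Fin m) (Fin m) ℝ :=
  (1 + s) • (1 : Matrix (Fin m) (Fin m) ℝ) - (s / 2) • triMat m

lemma triMat_nonneg {m : ℕ} (i j : Fin m) : 0 ≤ triMat m i j := by
  unfold triMat; split_ifs <;> norm_num

lemma sum_ite_eq_intCast {m : ℕ} (k : ℤ) (f : ℤ → ℝ) :
    ∑ j : Fin m, (if (j : ℤ) = k then f j else 0) = if 0 ≤ k ∧ k < m then f k else 0 := by
  split_ifs with h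
  · rw [Finset.sum_eq_single (⟨k.toNat, by omega⟩ : Fin m)]
    · have : ((k.toNat : ℕ) : ℤ) = k := by omega
      simp [h.1]
    · intro j _ hj
      rw [if_neg]
      intro hk
      apply hj
      ext
      simp only
      omega
    · simp
  · apply Finset.sum_eq_zero
    intro j _
    rw [if_neg]
    have := j.isLt
    omega

lemma triMat_sum_mul_s8 {m : ℕ} (f : ℤ → ℝ) (i : Fin m) :
    ∑ j, triMat m i j * f j =
      (if 0 < (i : ℤ) then f (i - 1) else 0) + (if (i : ℤ) + 1 < m then f (i + 1) else 0) := by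
  have key : ∀ j : Fin m, triMat m i j * f j =
      (if (j : ℤ) = i - 1 then f j else 0) + (if (j : ℤ) = i + 1 then f j else 0) := by
    intro j
    unfold triMat
    split_ifs <;> first | omega | simp
  have hi := i.isLt
  rw [Finset.sum_congr rfl fun j _ => key j, Finset.sum_add_distrib, sum_ite_eq_intCast,
    sum_ite_eq_intCast]
  congr 1
  · exact if_congr (by omega) rfl rfl
  · exact if_congr (by omega) rfl rfl

lemma triMat_sum_mul_le {m : ℕ} (f : ℤ → ℝ) (h0 : 0 ≤ f (-1)) (h1 : 0 ≤ f m) (i : Fin m) :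
    ∑ j, triMat m i j * f j ≤ f (i - 1) + f (i + 1) := by
  have hi := i.isLt
  rw [triMat_sum_mul_s8]
  apply add_le_add
  · split_ifs with h
    · exact le_rfl
    · rwa [show (i : ℤ) - 1 = -1 by omega]
  · split_ifs with h
    · exact le_rfl
    · rwa [show (i : ℤ) + 1 = m by omega]

lemma le_triMat_sum_mul {m : ℕ} (f : ℤ → ℝ) (h0 : f (-1) ≤ 0) (h1 : f m ≤ 0) (i : Fin m) :
    f (i - 1) + f (i + 1) ≤ ∑ j, triMat m i j * f j := by
  have := triMat_sum_mul_le (fun k => -f k) (by simpa using h0) (by simpa using h1) i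
  simp only [mul_neg, Finset.sum_neg_distrib] at this
  linarith

lemma sum_triMat_le_two {m : ℕ} (i : Fin m) : ∑ j, triMat m i j ≤ 2 := by
  have := triMat_sum_mul_le (fun _ => 1) zero_le_one zero_le_one i
  simp only [mul_one] at this
  linarith

lemma cnDenom_mulVec {m : ℕ} (s : ℝ) (x : Fin m → ℝ) (i : Fin m) :
    (cnDenom m s *ᵥ x) i = (1 + s) * x i - s / 2 * ∑ j, triMat m i j * x j := by
  simp only [cnDenom, sub_mulVec, smul_mulVec, one_mulVec, Pi.sub_apply, Pi.smul_apply,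
    smul_eq_mul]
  rfl

/-- Inverse positivity of `cnDenom`. -/
lemma nonneg_of_cnDenom_mulVec_nonneg {m : ℕ} {s : ℝ} (hs : 0 < s) {x : Fin m → ℝ}
    (hx : ∀ i, 0 ≤ (cnDenom m s *ᵥ x) i) (k : Fin m) : 0 ≤ x k := by
  have : Nonempty (Fin m) := ⟨k⟩
  obtain ⟨i, hi⟩ := Finite.exists_min x
  refine le_trans ?_ (hi k)
  by_contra! hneg
  have h1 : (∑ j, triMat m i j) * x i ≤ ∑ j, triMat m i j * x j := by
    rw [Finset.sum_mul]
    exact Finset.sum_le_sum fun j _ => mul_le_mul_of_nonneg_left (hi j) (triMat_nonneg i j)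
  have h2 : 2 * x i ≤ (∑ j, triMat m i j) * x i :=
    mul_le_mul_of_nonpos_right (sum_triMat_le_two i) hneg.le
  have h3 := hx i
  rw [cnDenom_mulVec] at h3
  nlinarith [mul_le_mul_of_nonneg_left (h2.trans h1) hs.le]

lemma isUnit_det_cnDenom (m : ℕ) {s : ℝ} (hs : 0 < s) : IsUnit (cnDenom m s).det := by
  rw [isUnit_iff_ne_zero]
  intro h
  obtain ⟨x, hx0, hx⟩ := exists_mulVec_eq_zero_iff.mpr h
  apply hx0
  ext k
  have h1 := nonneg_of_cnDenom_mulVec_nonneg hs (x := x) (by simp [hx]) k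
  have h2 := nonneg_of_cnDenom_mulVec_nonneg hs (x := -x) (by simp [mulVec_neg, hx]) k
  simp only [Pi.neg_apply, Pi.zero_apply] at h2 ⊢
  linarith

lemma cnDenom_inv_nonneg {m : ℕ} {s : ℝ} (hs : 0 < s) (i j : Fin m) :
    0 ≤ (cnDenom m s)⁻¹ i j := by
  refine nonneg_of_cnDenom_mulVec_nonneg hs (x := fun i => (cnDenom m s)⁻¹ i j) (fun k => ?_) i
  have h := congrFun (congrFun (mul_nonsing_inv _ (isUnit_det_cnDenom m hs)) k) j
  have h' : (cnDenom m s *ᵥ fun i => (cnDenom m s)⁻¹ i j) k =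
    (1 : Matrix (Fin m) (Fin m) ℝ) k j := h
  rw [h', one_apply]
  split_ifs <;> norm_num

lemma cnMat_eq (m : ℕ) {s : ℝ} (hs : 0 < s) :
    cnMat m s = (2 : ℝ) • (cnDenom m s)⁻¹ - 1 := by
  have h : (1 - s) • (1 : Matrix (Fin m) (Fin m) ℝ) + (s / 2) • triMat m =
      (2 : ℝ) • 1 - cnDenom m s := by
    unfold cnDenom
    module
  have h' : cnMat m s = (cnDenom m s)⁻¹ *
      ((1 - s) • (1 : Matrix (Fin m) (Fin m) ℝ) + (s / 2) • triMat m) := rfl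
  rw [h', h, mul_sub, nonsing_inv_mul _ (isUnit_det_cnDenom m hs), Matrix.mul_smul, mul_one]

lemma sum_abs_cnMat {m : ℕ} {s : ℝ} (hs : 0 < s) (i : Fin m) :
    ∑ j, |cnMat m s i j| = 2 * ∑ j, (cnDenom m s)⁻¹ i j - 2 * (cnDenom m s)⁻¹ i i +
      |2 * (cnDenom m s)⁻¹ i i - 1| := by
  rw [← Finset.add_sum_erase _ _ (Finset.mem_univ i),
    ← Finset.add_sum_erase _ (fun j => (cnDenom m s)⁻¹ i j) (Finset.mem_univ i)]
  have : ∀ j ∈ Finset.univ.erase i, |cnMat m s i j| = 2 * (cnDenom m s)⁻¹ i j := by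
    intro j hj
    have hij : i ≠ j := (Finset.ne_of_mem_erase hj).symm
    have := cnDenom_inv_nonneg hs i j
    simp [cnMat_eq m hs, one_apply_ne hij, abs_of_nonneg this]
  rw [Finset.sum_congr rfl this, ← Finset.mul_sum]
  simp only [cnMat_eq m hs, Matrix.sub_apply, Matrix.smul_apply, one_apply_eq, smul_eq_mul]
  ring

lemma sum_cnDenom_inv_mul {m : ℕ} {s : ℝ} (hs : 0 < s) (y : Fin m → ℝ) (i : Fin m) :
    ∑ j, (cnDenom m s)⁻¹ i j * (cnDenom m s *ᵥ y) j = y i := by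
  have h : (cnDenom m s)⁻¹ *ᵥ (cnDenom m s *ᵥ y) = y := by
    rw [mulVec_mulVec, nonsing_inv_mul _ (isUnit_det_cnDenom m hs), one_mulVec]
  exact congrFun h i

/-- `k ↦ r ^ |k|` solves the three-term recurrence away from the origin. -/
lemma pow_natAbs_recurrence {s r : ℝ} (hr : s / 2 * (1 + r ^ 2) = (1 + s) * r) {d : ℤ}
    (hd : d ≠ 0) :
    s / 2 * (r ^ (d - 1).natAbs + r ^ (d + 1).natAbs) = (1 + s) * r ^ d.natAbs := by
  obtain ⟨k, hk⟩ : ∃ k, d.natAbs = k + 1 := ⟨d.natAbs - 1, by omega⟩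
  have h : s / 2 * (r ^ k + r ^ (k + 2)) = (1 + s) * r ^ (k + 1) := by
    linear_combination r ^ k * hr
  rw [hk, ← h]
  rcases lt_or_gt_of_ne hd with hd | hd
  · rw [show (d - 1).natAbs = k + 2 by omega, show (d + 1).natAbs = k by omega, add_comm (r ^ k)]
  · rw [show (d - 1).natAbs = k by omega, show (d + 1).natAbs = k + 2 by omega]

lemma sum_cnDenom_inv_le_one {m : ℕ} {s : ℝ} (hs : 0 < s) (i : Fin m) :
    ∑ j, (cnDenom m s)⁻¹ i j ≤ 1 := by
  rw [← sum_cnDenom_inv_mul hs (fun _ => 1) i]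
  refine Finset.sum_le_sum fun j _ => le_mul_of_one_le_right (cnDenom_inv_nonneg hs i j) ?_
  rw [cnDenom_mulVec]
  have := sum_triMat_le_two j
  simp only [mul_one]
  nlinarith

lemma sum_mul_one_sub_two_delta {m : ℕ} (g : Fin m → ℝ) (i : Fin m) :
    ∑ j, g j * (1 - if j = i then 2 else 0) = ∑ j, g j - 2 * g i := by
  simp [mul_sub, Finset.sum_sub_distrib, mul_comm]

/-- The root in `(0, 1)` of the characteristic equation, written through `q = √(1 + 2 s)`. -/
lemma exists_root {s : ℝ} (hs : 0 < s) :
    ∃ q r : ℝ, 1 < q ∧ q ^ 2 = 1 + 2 * s ∧ 0 < r ∧ r < 1 ∧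
      s / 2 * (1 + r ^ 2) = (1 + s) * r ∧ s * (1 - r) = q - 1 := by
  have hq2 : √(1 + 2 * s) ^ 2 = 1 + 2 * s := Real.sq_sqrt (by linarith)
  have hq : 1 < √(1 + 2 * s) := by
    rw [Real.lt_sqrt zero_le_one]; linarith
  generalize √(1 + 2 * s) = q at hq hq2
  obtain rfl : s = (q ^ 2 - 1) / 2 := by linarith
  have h1 : q + 1 ≠ 0 := by linarith
  refine ⟨q, (q - 1) / (q + 1), hq, hq2, div_pos (by linarith) (by linarith), ?_, ?_, ?_⟩
  · rw [div_lt_one (by linarith)]; linarith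
  · field_simp; ring
  · field_simp; ring

lemma sum_cnDenom_inv_le_two_mul_diag {m : ℕ} {s : ℝ} (hs : 0 < s) (hs' : s ≤ 3 / 2)
    (i : Fin m) : ∑ j, (cnDenom m s)⁻¹ i j ≤ 2 * (cnDenom m s)⁻¹ i i := by
  obtain ⟨q, r, hq, hq2, hr0, hr1, hr, hsr⟩ := exists_root hs
  have hq' : q ≤ 2 := by nlinarith
  set f : ℤ → ℝ := fun k => 1 - r ^ (k - i).natAbs with hf
  have hf0 : ∀ k, 0 ≤ f k := fun k => sub_nonneg.mpr (pow_le_one₀ hr0.le hr1.le)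
  have hy := sum_cnDenom_inv_mul hs (fun j => f j) i
  have hle : ∑ j, (cnDenom m s)⁻¹ i j * (1 - if j = i then 2 else 0) ≤
      ∑ j, (cnDenom m s)⁻¹ i j * (cnDenom m s *ᵥ fun j => f j) j := by
    refine Finset.sum_le_sum fun j _ => mul_le_mul_of_nonneg_left ?_ (cnDenom_inv_nonneg hs i j)
    rw [cnDenom_mulVec]
    have h1 := mul_le_mul_of_nonneg_left (triMat_sum_mul_le f (hf0 _) (hf0 _) j)
      (half_pos hs).le
    refine le_trans ?_ (sub_le_sub_left h1 _)
    simp only [hf]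
    split_ifs with hj
    · subst hj
      simp
      linarith
    · have hd : (j : ℤ) - i ≠ 0 := fun h => hj (Fin.ext (by omega))
      have := pow_natAbs_recurrence hr hd
      rw [show (j : ℤ) - 1 - i = j - i - 1 by ring, show (j : ℤ) + 1 - i = j - i + 1 by ring]
      linarith
  rw [hy, sum_mul_one_sub_two_delta] at hle
  simp [hf] at hle
  linarith

lemma exists_two_mul_diag_lt_sum {s : ℝ} (hs : 3 / 2 < s) :
    ∃ (m : ℕ) (i : Fin m), 2 * (cnDenom m s)⁻¹ i i < ∑ j, (cnDenom m s)⁻¹ i j := by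
  have hs0 : 0 < s := by linarith
  obtain ⟨q, r, hq, hq2, hr0, hr1, hr, hsr⟩ := exists_root hs0
  have hq' : 2 < q := by nlinarith
  have hr' : s / 2 * (1 + r⁻¹ ^ 2) = (1 + s) * r⁻¹ := by
    field_simp
    linarith
  have hε : 0 < (1 - 2 / q) / 2 := by
    have : 2 / q < 1 := (div_lt_one (by linarith)).mpr hq'
    linarith
  obtain ⟨n, hn⟩ := exists_pow_lt_of_lt_one hε hr1
  have hδ0 : 0 < r ^ (n + 1) := by positivity
  have hδ : r ^ (n + 1) < (1 - 2 / q) / 2 :=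
    lt_of_le_of_lt (pow_le_pow_of_le_one hr0.le hr1.le n.le_succ) hn
  have hinv : r ^ (n + 1) * r⁻¹ ^ (n + 1) = 1 := by
    rw [← mul_pow, mul_inv_cancel₀ hr0.ne', one_pow]
  set δ := r ^ (n + 1) with hδdef
  have hK0 : 0 ≤ 2 / q + δ := by positivity
  have hKq : (2 / q + δ) * q = 2 + δ * q := by
    field_simp
  set K := 2 / q + δ with hK
  refine ⟨2 * n + 1, ⟨n, by omega⟩, ?_⟩
  set i : Fin (2 * n + 1) := ⟨n, by omega⟩ with hi
  set f : ℤ → ℝ := fun k => 1 - K * r ^ (k - n).natAbs - δ * r⁻¹ ^ (k - n).natAbs with hf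
  have hend : ∀ k : ℤ, (k - n).natAbs = n + 1 → f k ≤ 0 := by
    intro k hk
    simp only [hf, hk, hinv]
    have : 0 ≤ K * r ^ (n + 1) := by positivity
    linarith
  have hy := sum_cnDenom_inv_mul hs0 (fun j => f j) i
  have hle : ∑ j, (cnDenom (2 * n + 1) s)⁻¹ i j * (cnDenom (2 * n + 1) s *ᵥ fun j => f j) j ≤
      ∑ j, (cnDenom (2 * n + 1) s)⁻¹ i j * (1 - if j = i then 2 else 0) := by
    refine Finset.sum_le_sum fun j _ => mul_le_mul_of_nonneg_left ?_ (cnDenom_inv_nonneg hs0 i j)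
    rw [cnDenom_mulVec]
    have h1 := mul_le_mul_of_nonneg_left
      (le_triMat_sum_mul f (hend _ (by omega)) (hend _ (by push_cast; omega)) j)
      (half_pos hs0).le
    refine le_trans (sub_le_sub_left h1 _) ?_
    simp only [hf]
    split_ifs with hj
    · subst hj
      have hc : s / 2 * (r + r⁻¹) = 1 + s := by
        field_simp
        linarith
      simp [hi]
      apply le_of_eq
      linear_combination (-K + δ) * hsr - hKq + 2 * δ * hc
    · have hd : (j : ℤ) - n ≠ 0 := fun h => hj (Fin.ext (by simp only [hi]; omega))
      have e1 := pow_natAbs_recurrence hr hd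
      have e2 := pow_natAbs_recurrence hr' hd
      rw [show (j : ℤ) - 1 - n = j - n - 1 by ring, show (j : ℤ) + 1 - n = j - n + 1 by ring]
      apply le_of_eq
      linear_combination K * e1 + δ * e2
  rw [hy, sum_mul_one_sub_two_delta] at hle
  simp only [hf, hi, sub_self, Int.natAbs_zero, pow_zero, mul_one] at hle
  linarith

theorem stmt8 (s : ℝ) (hs : 0 < s) :
    (∀ m : ℕ, 1 ≤ m → maxNorm (cnMat m s) ≤ 1) ↔ s ≤ 3 / 2 := by
  constructor
  · intro h
    by_contra! hlt
    obtain ⟨m, i, hi⟩ := exists_two_mul_diag_lt_sum hlt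
    have hrow : ∑ j, |cnMat m s i j| ≤ 1 :=
      (le_ciSup (f := fun i => ∑ j, |cnMat m s i j|) (Set.finite_range _).bddAbove i).trans
        (h m (Nat.one_le_of_lt i.isLt))
    rw [sum_abs_cnMat hs] at hrow
    have := neg_abs_le (2 * (cnDenom m s)⁻¹ i i - 1)
    linarith
  · intro hle m hm
    have : Nonempty (Fin m) := ⟨⟨0, hm⟩⟩
    refine ciSup_le fun i => ?_
    rw [sum_abs_cnMat hs]
    have h1 := sum_cnDenom_inv_le_one hs i
    have h2 := sum_cnDenom_inv_le_two_mul_diag hs hle i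
    rcases abs_cases (2 * (cnDenom m s)⁻¹ i i - 1) with ⟨h, _⟩ | ⟨h, _⟩ <;> linarith
end
end

section
/- For every integer m ≥ 1, the polynomial P_m has exactly m − 1 roots in the open interval (−1, 1); that is, the set {x ∈ ℝ : −1 < x < 1 and P_m(x) = 0} has exactly m − 1 elements. -/
open Real Matrix Filter

noncomputable section

theorem natDegree_polyP_le (n : ℕ) : (polyP n).natDegree ≤ n := by
  induction n using Nat.twoStepInduction with
  | zero => simp [polyP]
  | one => unfold polyP; compute_degree
  | more n ih₁ ih₂ =>
    unfold polyP
    refine (Polynomial.natDegree_sub_le _ _).trans (max_le ?_ (by omega))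
    refine Polynomial.natDegree_mul_le.trans ?_
    have hX : (2 * Polynomial.X : Polynomial ℝ).natDegree ≤ 1 := by compute_degree
    omega

theorem eval_polyP_add_two (n : ℕ) (x : ℝ) :
    (polyP (n + 2)).eval x = 2 * x * (polyP (n + 1)).eval x - (polyP n).eval x := by
  simp [polyP]

theorem eval_polyP_zero (x : ℝ) : (polyP 0).eval x = -1 := by simp [polyP]

theorem eval_polyP_one (x : ℝ) : (polyP 1).eval x = 2 * x - 4 := by simp [polyP]

theorem polyP_eval_one (n : ℕ) : (polyP n).eval 1 = -(n + 1) := by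
  induction n using Nat.twoStepInduction with
  | zero => simp [eval_polyP_zero]
  | one => rw [eval_polyP_one]; norm_num
  | more n ih₁ ih₂ =>
    rw [eval_polyP_add_two, ih₁, ih₂]
    push_cast
    ring

theorem polyP_eval_two_nonneg (n : ℕ) :
    0 ≤ (polyP (n + 1)).eval 2 ∧ (polyP n).eval 2 ≤ (polyP (n + 1)).eval 2 := by
  induction n with
  | zero => norm_num [eval_polyP_zero, eval_polyP_one]
  | succ n ih =>
    rw [eval_polyP_add_two]
    constructor <;> linarith [ih.1, ih.2]

theorem polyP_eval_cos_mul_sin (n : ℕ) (θ : ℝ) :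
    (polyP n).eval (cos θ) * sin θ = -cos (n * θ) * sin θ + (3 * cos θ - 4) * sin (n * θ) := by
  induction n using Nat.twoStepInduction with
  | zero => simp [eval_polyP_zero]
  | one => rw [eval_polyP_one, Nat.cast_one, one_mul]; ring
  | more n ih₁ ih₂ =>
    have hc : cos ((n + 2 : ℕ) * θ) = 2 * cos θ * cos ((n + 1 : ℕ) * θ) - cos (n * θ) := by
      have h₁ : ((n + 2 : ℕ) : ℝ) * θ = (n + 1 : ℕ) * θ + θ := by push_cast; ring
      have h₂ : (n : ℝ) * θ = (n + 1 : ℕ) * θ - θ := by push_cast; ring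
      rw [h₁, h₂, cos_add, cos_sub]; ring
    have hs : sin ((n + 2 : ℕ) * θ) = 2 * cos θ * sin ((n + 1 : ℕ) * θ) - sin (n * θ) := by
      have h₁ : ((n + 2 : ℕ) : ℝ) * θ = (n + 1 : ℕ) * θ + θ := by push_cast; ring
      have h₂ : (n : ℝ) * θ = (n + 1 : ℕ) * θ - θ := by push_cast; ring
      rw [h₁, h₂, sin_add, sin_sub]; ring
    rw [eval_polyP_add_two, hc, hs]
    linear_combination 2 * cos θ * ih₂ - ih₁

theorem neg_one_pow_mul_polyP_eval_cos_neg {m k : ℕ} (hk : k < m) :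
    (-1) ^ k * (polyP m).eval (cos (k * π / m)) < 0 := by
  rcases Nat.eq_zero_or_pos k with rfl | hk₀
  · simp only [pow_zero, Nat.cast_zero, zero_mul, zero_div, cos_zero, polyP_eval_one]
    have : (0 : ℝ) ≤ m := m.cast_nonneg
    linarith
  · have hm : (0 : ℝ) < m := by exact_mod_cast hk₀.trans hk
    have hkm : (k : ℝ) < m := by exact_mod_cast hk
    have hk' : (0 : ℝ) < k := by exact_mod_cast hk₀
    have hsin : 0 < sin (k * π / m) := by
      apply sin_pos_of_pos_of_lt_pi (by positivity)
      rw [div_lt_iff₀ hm, mul_comm π]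
      exact mul_lt_mul_of_pos_right hkm pi_pos
    have h := polyP_eval_cos_mul_sin m (k * π / m)
    rw [mul_div_cancel₀ _ hm.ne', sin_nat_mul_pi, cos_nat_mul_pi, mul_zero, add_zero] at h
    rw [mul_right_cancel₀ hsin.ne' h, mul_neg, ← mul_pow]
    norm_num

theorem exists_polyP_root_between {m k : ℕ} (hk : k + 1 < m) :
    ∃ x : ℝ, cos ((k + 1 : ℕ) * π / m) < x ∧ x < cos (k * π / m) ∧ (polyP m).eval x = 0 := by
  have h₀ := neg_one_pow_mul_polyP_eval_cos_neg (Nat.lt_of_succ_lt hk)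
  have h₁ := neg_one_pow_mul_polyP_eval_cos_neg hk
  have hm : (0 : ℝ) < m := by exact_mod_cast (Nat.succ_pos k).trans hk
  have hkm : ((k + 1 : ℕ) : ℝ) ≤ m := by exact_mod_cast hk.le
  have hle : cos ((k + 1 : ℕ) * π / m) ≤ cos (k * π / m) := by
    apply cos_le_cos_of_nonneg_of_le_pi (by positivity)
    · rw [div_le_iff₀ hm, mul_comm π]
      gcongr
    · gcongr
      omega
  have hcont : ContinuousOn (fun x : ℝ => (-1) ^ k * (polyP m).eval x)
      (Set.Icc (cos ((k + 1 : ℕ) * π / m)) (cos (k * π / m))) := by fun_prop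
  obtain ⟨x, hx, hx₀⟩ := intermediate_value_Ioo' hle hcont
    (show (0 : ℝ) ∈ _ from ⟨h₀, by rw [pow_succ] at h₁; linarith⟩)
  exact ⟨x, hx.1, hx.2, by simpa using hx₀⟩

theorem exists_polyP_root_gt_one {m : ℕ} (hm : 1 ≤ m) :
    ∃ x : ℝ, 1 < x ∧ (polyP m).eval x = 0 := by
  obtain ⟨n, rfl⟩ := Nat.exists_eq_add_of_le' hm
  have hcont : ContinuousOn (fun x : ℝ => (polyP (n + 1)).eval x) (Set.Icc 1 2) := by fun_prop
  have h₁ : (polyP (n + 1)).eval (1 : ℝ) < 0 := by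
    rw [polyP_eval_one]
    have : (0 : ℝ) ≤ (n + 1 : ℕ) := Nat.cast_nonneg _
    linarith
  obtain ⟨x, hx, hx₀⟩ := intermediate_value_Ioc one_le_two hcont
    (show (0 : ℝ) ∈ _ from ⟨h₁, (polyP_eval_two_nonneg n).1⟩)
  exact ⟨x, hx.1, hx₀⟩

theorem polyP_ne_zero (m : ℕ) : polyP m ≠ 0 := by
  intro h
  have h₁ := polyP_eval_one m
  rw [h, Polynomial.eval_zero] at h₁
  have : (0 : ℝ) ≤ m := m.cast_nonneg
  linarith

theorem encard_polyP_roots_le {m : ℕ} (hm : 1 ≤ m) :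
    {x : ℝ | -1 < x ∧ x < 1 ∧ (polyP m).eval x = 0}.encard ≤ (m - 1 : ℕ) := by
  obtain ⟨y, hy, hy₀⟩ := exists_polyP_root_gt_one hm
  have hmem : y ∈ (polyP m).roots.toFinset := by
    simpa [polyP_ne_zero m] using hy₀
  have hsub : {x : ℝ | -1 < x ∧ x < 1 ∧ (polyP m).eval x = 0} ⊆
      ((polyP m).roots.toFinset.erase y : Finset ℝ) := by
    rintro x ⟨-, hx, hx₀⟩
    simp only [Finset.coe_erase, Set.mem_sdiff, Set.mem_singleton_iff, Finset.mem_coe,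
      Multiset.mem_toFinset, Polynomial.mem_roots (polyP_ne_zero m)]
    exact ⟨hx₀, (hx.trans hy).ne⟩
  refine (Set.encard_le_encard hsub).trans ?_
  rw [Set.encard_coe_eq_coe_finsetCard, Finset.card_erase_of_mem hmem, Nat.cast_le]
  have h₁ := Multiset.toFinset_card_le (polyP m).roots
  have h₂ := Polynomial.card_roots' (polyP m)
  have h₃ := natDegree_polyP_le m
  omega

theorem le_encard_polyP_roots (m : ℕ) :
    ((m - 1 : ℕ) : ℕ∞) ≤ {x : ℝ | -1 < x ∧ x < 1 ∧ (polyP m).eval x = 0}.encard := by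
  have hex : ∀ k : Fin (m - 1), ∃ x : ℝ,
      cos ((k + 1 : ℕ) * π / m) < x ∧ x < cos (k * π / m) ∧ (polyP m).eval x = 0 :=
    fun k => exists_polyP_root_between (by omega)
  choose r hlo hhi hr using hex
  have hanti : StrictAnti r := by
    intro j k hjk
    have hm : (0 : ℝ) < m := by exact_mod_cast (show 0 < m by omega)
    refine (hhi k).trans_le (le_trans ?_ (hlo j).le)
    apply cos_le_cos_of_nonneg_of_le_pi (by positivity)
    · rw [div_le_iff₀ hm, mul_comm π]
      gcongr
      omega
    · gcongr
      exact hjk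
  have hsub : Set.range r ⊆ {x : ℝ | -1 < x ∧ x < 1 ∧ (polyP m).eval x = 0} := by
    rintro _ ⟨k, rfl⟩
    exact ⟨(neg_one_le_cos _).trans_lt (hlo k), (hhi k).trans_le (cos_le_one _), hr k⟩
  calc ((m - 1 : ℕ) : ℕ∞) = (Set.range r).encard := by
        rw [← Set.image_univ, hanti.injective.encard_image]
        simp
    _ ≤ _ := Set.encard_le_encard hsub

theorem stmt12 (m : ℕ) (hm : 1 ≤ m) :
    {x : ℝ | -1 < x ∧ x < 1 ∧ (polyP m).eval x = 0}.encard = (m - 1 : ℕ) := by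
  exact le_antisymm (encard_polyP_roots_le hm) (le_encard_polyP_roots m)
end
end
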